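/- For every natural number n ≥ 2, there exists a finite regular simple graph G with χ(G) = n and dynamic chromatic number χ₂(G) = 2·χ(G) = 2n. -/

import Mathlib

open SimpleGraph

/-- `c` is an `r`-dynamic colouring of `G` with colour set `[t] = {0, …, t-1}`:
a proper colouring such that at least `min r (deg v)` colours are used on the
neighbourhood of every vertex `v`. -/
def IsDynamicColoring {V : Type*} (G : SimpleGraph V) (r t : ℕ) (c : V → ℕ) : Prop :=
  (∀ v, c v < t) ∧ (∀ u v, G.Adj u v → c u ≠ c v) ∧
    ∀ v : V, min r (G.neighborSet v).ncard ≤ (c '' G.neighborSet v).ncard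

/-- The `r`-dynamic chromatic number `χ_r(G)`: the least `t` admitting an
`r`-dynamic colouring with `t` colours. -/
noncomputable def dynChromaticNumber {V : Type*} (G : SimpleGraph V) (r : ℕ) : ℕ :=
  sInf {t | ∃ c : V → ℕ, IsDynamicColoring G r t c}

/-- `K` copies of the complete `n`-partite graph with parts of size `m`, together with, for each
part index `i` and each `n`-set `J` of copies, a vertex joined to the `i`-th parts of the copies
in `J`. -/
def multipartiteSystem (K n m : ℕ) :
    SimpleGraph ((Fin K × Fin n × Fin m) ⊕ (Fin n × {J : Finset (Fin K) // J.card = n})) where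
  Adj
    | .inl p, .inl q => p.1 = q.1 ∧ p.2.1 ≠ q.2.1
    | .inl p, .inr w => p.2.1 = w.1 ∧ p.1 ∈ w.2.1
    | .inr w, .inl p => p.2.1 = w.1 ∧ p.1 ∈ w.2.1
    | .inr _, .inr _ => False
  symm := ⟨by
    rintro (p | w) (q | w') h
    · exact ⟨h.1.symm, h.2.symm⟩
    all_goals exact h⟩
  loopless := ⟨by
    rintro (p | w) h
    · exact h.2 rfl
    · exact h⟩

namespace multipartiteSystem

variable {K n m : ℕ}

theorem neighborSet_inr (i : Fin n) (J : {J : Finset (Fin K) // J.card = n}) :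
    (multipartiteSystem K n m).neighborSet (.inr (i, J)) =
      Sum.inl '' ((J.1 : Set (Fin K)) ×ˢ ({i} ×ˢ Set.univ)) := by
  ext (⟨j', i', a'⟩ | ⟨i', J'⟩) <;> simp [multipartiteSystem, and_comm]

theorem neighborSet_inl (j : Fin K) (i : Fin n) (a : Fin m) :
    (multipartiteSystem K n m).neighborSet (.inl (j, i, a)) =
      Sum.inl '' ({j} ×ˢ ({i}ᶜ ×ˢ Set.univ)) ∪ Sum.inr '' ({i} ×ˢ {J | j ∈ J.1}) := by
  ext (⟨j', i', a'⟩ | ⟨i', J'⟩) <;> simp [multipartiteSystem, eq_comm]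

theorem ncard_subsets_containing (hn : 1 ≤ n) (j : Fin K) :
    {J : {J : Finset (Fin K) // J.card = n} | j ∈ J.1}.ncard = (K - 1).choose (n - 1) := by
  have h : (Subtype.val '' {J : {J : Finset (Fin K) // J.card = n} | j ∈ J.1}) =
      ((((Finset.univ.erase j).powersetCard (n - 1)).image (insert j) : Finset _) :
        Set (Finset (Fin K))) := by
    ext J
    simp only [Set.mem_image, Set.mem_ofPred_eq, Subtype.exists, Finset.coe_image,
      Finset.mem_coe, Finset.mem_powersetCard]
    constructor
    · rintro ⟨J, hJ, hj, rfl⟩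
      refine ⟨J.erase j, ⟨Finset.erase_subset_erase _ (Finset.subset_univ _), ?_⟩,
        Finset.insert_erase hj⟩
      rw [Finset.card_erase_of_mem hj, hJ]
    · rintro ⟨I, ⟨hI, hc⟩, rfl⟩
      have : j ∉ I := fun h => by simpa using hI h
      exact ⟨_, by rw [Finset.card_insert_of_notMem this]; omega, by simp, rfl⟩
  rw [← Set.ncard_image_of_injective _ Subtype.val_injective, h, Set.ncard_coe_finset,
    Finset.card_image_of_injOn, Finset.card_powersetCard, Finset.card_erase_of_mem (by simp),
    Finset.card_univ, Fintype.card_fin]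
  intro I hI I' hI' h
  have aux : ∀ {I : Finset (Fin K)},
      I ∈ ((Finset.univ.erase j).powersetCard (n - 1) : Set (Finset (Fin K))) → j ∉ I := by
    intro I hI h
    simpa using (Finset.mem_powersetCard.1 hI).1 h
  rw [← Finset.erase_insert (aux hI), ← Finset.erase_insert (aux hI')]
  exact congrArg (·.erase j) h

theorem ncard_neighborSet (hn : 1 ≤ n) (hm : m = (K - 1).choose (n - 1))
    (v : (Fin K × Fin n × Fin m) ⊕ (Fin n × {J : Finset (Fin K) // J.card = n})) :
    ((multipartiteSystem K n m).neighborSet v).ncard = n * m := by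
  rcases v with ⟨j, i, a⟩ | ⟨i, J⟩
  · rw [neighborSet_inl, Set.ncard_union_eq, Set.ncard_image_of_injective _ Sum.inl_injective,
      Set.ncard_image_of_injective _ Sum.inr_injective, Set.ncard_prod, Set.ncard_prod,
      Set.ncard_prod, ncard_subsets_containing hn, ← hm, Set.ncard_compl]
    · obtain ⟨k, rfl⟩ := Nat.exists_eq_add_of_le' hn
      simp [Set.ncard_univ]
      ring
    · rw [Set.disjoint_left]
      rintro _ ⟨x, -, rfl⟩ ⟨y, -, h⟩
      cases h
  · rw [neighborSet_inr, Set.ncard_image_of_injective _ Sum.inl_injective, Set.ncard_prod,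
      Set.ncard_prod, Set.ncard_coe_finset, J.2]
    simp [Set.ncard_univ]

/-- Parts get their index as colour; the additional vertices get the cyclically next index. -/
def partColor :
    (Fin K × Fin n × Fin m) ⊕ (Fin n × {J : Finset (Fin K) // J.card = n}) → Fin n
  | .inl p => p.2.1
  | .inr w => finRotate n w.1

theorem partColor_ne (hn : 2 ≤ n) {u v} (h : (multipartiteSystem K n m).Adj u v) :
    partColor u ≠ partColor v := by
  have aux : ∀ i : Fin n, finRotate n i ≠ i := by
    intro i
    obtain ⟨k, rfl⟩ := Nat.exists_eq_add_of_le' hn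
    simp
  rcases u with p | w <;> rcases v with q | w'
  · exact h.2
  · rw [partColor, partColor, h.1]
    exact (aux _).symm
  · rw [partColor, partColor, h.1]
    exact aux _
  · exact h.elim

theorem chromaticNumber_eq (hn : 2 ≤ n) (hK : 1 ≤ K) (hm : 1 ≤ m) :
    (multipartiteSystem K n m).chromaticNumber = n := by
  apply le_antisymm
  · have h : (multipartiteSystem K n m).Colorable (Fintype.card (Fin n)) :=
      (SimpleGraph.Coloring.mk partColor fun h => partColor_ne hn h).colorable
    rw [Fintype.card_fin] at h
    exact h.chromaticNumber_le
  · exact SimpleGraph.le_chromaticNumber_of_pairwise_adj (ι := Fin n) (by simp)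
      (fun i => .inl (⟨0, hK⟩, i, ⟨0, hm⟩)) fun i i' h => ⟨rfl, h⟩

/-- Every neighbourhood contains an entire part. -/
theorem exists_part_subset (hn : 2 ≤ n)
    (v : (Fin K × Fin n × Fin m) ⊕ (Fin n × {J : Finset (Fin K) // J.card = n})) :
    ∃ j i, ∀ a, .inl (j, i, a) ∈ (multipartiteSystem K n m).neighborSet v := by
  rcases v with ⟨j, i, a⟩ | ⟨i, J⟩
  · have : Nontrivial (Fin n) := Fin.nontrivial_iff_two_le.2 hn
    obtain ⟨i', hi⟩ := exists_ne i
    exact ⟨j, i', fun a => ⟨rfl, hi.symm⟩⟩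
  · obtain ⟨j, hj⟩ : J.1.Nonempty := Finset.card_pos.1 (by rw [J.2]; omega)
    exact ⟨j, i, fun a => ⟨rfl, hj⟩⟩

/-- `partColor` refined by splitting every part in two. -/
def splitColor :
    (Fin K × Fin n × Fin m) ⊕ (Fin n × {J : Finset (Fin K) // J.card = n}) → ℕ
  | .inl p => 2 * (partColor (.inl p : _ ⊕ (Fin n × {J : Finset (Fin K) // J.card = n}))).val +
      if p.2.2.val = 0 then 0 else 1
  | .inr w => 2 * (partColor (.inr w : (Fin K × Fin n × Fin m) ⊕ _)).val

theorem splitColor_div_two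
    (v : (Fin K × Fin n × Fin m) ⊕ (Fin n × {J : Finset (Fin K) // J.card = n})) :
    splitColor v / 2 = partColor v := by
  rcases v with p | w
  · simp only [splitColor]
    split_ifs <;> omega
  · simp [splitColor]

theorem isDynamicColoring_splitColor (hn : 2 ≤ n) (hm : 2 ≤ m) :
    IsDynamicColoring (multipartiteSystem K n m) 2 (2 * n) splitColor := by
  refine ⟨fun v => ?_, fun u v h huv => ?_, fun v => ?_⟩
  · have h := splitColor_div_two v
    have := (partColor v).2
    omega
  · apply partColor_ne hn h
    rw [Fin.ext_iff, ← splitColor_div_two, ← splitColor_div_two, huv]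
  · obtain ⟨j, i, hji⟩ := exists_part_subset hn v
    refine (min_le_left _ _).trans ((Set.one_lt_ncard (Set.toFinite _)).2
      ⟨_, ⟨_, hji ⟨0, by omega⟩, rfl⟩, _, ⟨_, hji ⟨1, by omega⟩, rfl⟩, ?_⟩)
    simp [splitColor, partColor]

theorem exists_monochromatic_part {t : ℕ} (ht : t < 2 * n) (hm : 1 ≤ m)
    {c : (Fin K × Fin n × Fin m) ⊕ (Fin n × {J : Finset (Fin K) // J.card = n}) → ℕ}
    (hc : IsDynamicColoring (multipartiteSystem K n m) 2 t c) (j : Fin K) :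
    ∃ (i : Fin n) (x : Fin t), ∀ a, c (.inl (j, i, a)) = x := by
  by_contra! h
  choose b hb using fun i : Fin n => h i ⟨c (.inl (j, i, ⟨0, hm⟩)), hc.1 _⟩
  let f : Fin n × Bool → Fin t := fun p =>
    ⟨c (.inl (j, p.1, if p.2 then b p.1 else ⟨0, hm⟩)), hc.1 _⟩
  have hf : Function.Injective f := by
    rintro ⟨i, s⟩ ⟨i', s'⟩ hff
    rw [Fin.mk.injEq] at hff
    obtain rfl : i = i' := by
      by_contra hne
      refine hc.2.1 _ _ ?_ hff
      exact ⟨rfl, hne⟩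
    have := hb i
    cases s <;> cases s' <;> simp_all [eq_comm]
  have := Fintype.card_le_of_injective f hf
  simp at this
  omega

theorem two_mul_le_of_isDynamicColoring {t : ℕ} (hK : n * (2 * n) * n ≤ K)
    (hn : 2 ≤ n) (hm : 1 ≤ m)
    {c : (Fin K × Fin n × Fin m) ⊕ (Fin n × {J : Finset (Fin K) // J.card = n}) → ℕ}
    (hc : IsDynamicColoring (multipartiteSystem K n m) 2 t c) : 2 * n ≤ t := by
  by_contra! ht
  choose i x hx using exists_monochromatic_part ht hm hc
  obtain ⟨⟨i₀, x₀⟩, hfib⟩ := Fintype.exists_lt_card_fiber_of_mul_lt_card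
    (f := fun j => (i j, x j)) (n := n - 1) (by
      simp only [Fintype.card_prod, Fintype.card_fin]
      calc n * t * (n - 1) ≤ n * (2 * n) * (n - 1) := by gcongr
        _ < n * (2 * n) * n := by
          apply Nat.mul_lt_mul_of_pos_left <;> first | omega | positivity
        _ ≤ K := hK)
  obtain ⟨J, hJ, hJn⟩ := Finset.exists_subset_card_eq (show n ≤ _ by exact Nat.le_of_pred_lt hfib)
  have hmem : ∀ j ∈ J, i j = i₀ ∧ x j = x₀ := fun j hj => by simpa using hJ hj
  have hdyn := hc.2.2 (.inr (i₀, ⟨J, hJn⟩))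
  rw [neighborSet_inr, Set.ncard_image_of_injective _ Sum.inl_injective, Set.ncard_prod,
    Set.ncard_prod, Set.ncard_coe_finset, hJn, Set.ncard_singleton, Set.ncard_univ,
    Nat.card_eq_fintype_card, Fintype.card_fin] at hdyn
  have hle : (c '' (Sum.inl '' ((J : Set (Fin K)) ×ˢ ({i₀} ×ˢ (Set.univ : Set (Fin m)))))).ncard
      ≤ ({(x₀ : ℕ)} : Set ℕ).ncard := by
    refine Set.ncard_le_ncard ?_
    rintro _ ⟨_, ⟨⟨j, i', a⟩, ⟨hj, hi, -⟩, rfl⟩, rfl⟩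
    obtain ⟨hij, hxj⟩ := hmem j hj
    obtain rfl : i' = i₀ := hi
    rw [Set.mem_singleton_iff, ← hxj, ← hx j a, hij]
  rw [Set.ncard_singleton] at hle
  have : 2 ≤ n * (1 * m) := by nlinarith
  exact absurd ((le_min le_rfl this).trans (hdyn.trans hle)) (by norm_num)

end multipartiteSystem

theorem image_neighborSet_iso {V W : Type*} {G : SimpleGraph V} {H : SimpleGraph W}
    (e : G ≃g H) (v : V) : e '' G.neighborSet v = H.neighborSet (e v) := by
  ext w
  obtain ⟨u, rfl⟩ := e.surjective w
  simp [e.map_adj_iff]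

theorem IsDynamicColoring.comp_iso {V W : Type*} {G : SimpleGraph V} {H : SimpleGraph W}
    (e : G ≃g H) {r t : ℕ} {c : W → ℕ} (hc : IsDynamicColoring H r t c) :
    IsDynamicColoring G r t (c ∘ e) := by
  refine ⟨fun v => hc.1 _, fun u v h => hc.2.1 _ _ (e.map_adj_iff.2 h), fun v => ?_⟩
  have := hc.2.2 (e v)
  rwa [← image_neighborSet_iso, Set.ncard_image_of_injective _ e.injective,
    ← Set.image_comp] at this

theorem stmt1 (n : ℕ) (hn : 2 ≤ n) :
    ∃ (t : ℕ) (G : SimpleGraph (Fin t)) (d : ℕ),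
      (∀ v, (G.neighborSet v).ncard = d) ∧
      G.chromaticNumber = n ∧
      dynChromaticNumber G 2 = 2 * n := by
  set K := n * (2 * n) * n with hK
  set m := (K - 1).choose (n - 1) with hm
  have hnK : n < K := by
    rw [hK]
    nlinarith [Nat.mul_le_mul hn hn]
  have hm2 : 2 ≤ m := by
    obtain ⟨k, hk⟩ : ∃ k, K - 1 = k + 1 := ⟨K - 2, by omega⟩
    obtain ⟨l, hl⟩ : ∃ l, n - 1 = l + 1 := ⟨n - 2, by omega⟩
    rw [hm, hk, hl, Nat.choose_succ_succ']
    have h₁ : 0 < k.choose l := Nat.choose_pos (by omega)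
    have h₂ : 0 < k.choose (l + 1) := Nat.choose_pos (by omega)
    omega
  let e := SimpleGraph.overFinIso (multipartiteSystem K n m) rfl
  refine ⟨_, SimpleGraph.overFin (multipartiteSystem K n m) rfl, n * m, fun v => ?_, ?_, ?_⟩
  · rw [← multipartiteSystem.ncard_neighborSet (by omega) hm (e.symm v),
      ← image_neighborSet_iso e.symm, Set.ncard_image_of_injective _ e.symm.injective]
  · rw [← multipartiteSystem.chromaticNumber_eq (K := K) hn (by omega) (by omega : 1 ≤ m)]
    exact le_antisymm (SimpleGraph.chromaticNumber_mono_of_hom e.symm.toHom)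
      (SimpleGraph.chromaticNumber_mono_of_hom e.toHom)
  · have hmem := (multipartiteSystem.isDynamicColoring_splitColor (K := K) hn hm2).comp_iso e.symm
    refine le_antisymm (Nat.sInf_le ⟨_, hmem⟩) (le_csInf ⟨_, _, hmem⟩ ?_)
    rintro t ⟨c, hc⟩
    exact multipartiteSystem.two_mul_le_of_isDynamicColoring hK.ge hn (by omega) (hc.comp_iso e)
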